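/- In Version B, every position in which all pile sizes are even is a P-position. -/

import Mathlib

/-- Remove one token from a pile of size `p` in `G`: delete one copy of `p` and,
if `p ≠ 1`, add back a pile of size `p - 1`. -/
def takeOne (G : Multiset ℕ) (p : ℕ) : Multiset ℕ :=
  G.erase p + (if p = 1 then (0 : Multiset ℕ) else {p - 1})

/-- Legal moves of Version B: remove one token from one chosen pile, or remove
one token from every pile simultaneously (piles reaching size 0 are deleted). -/
inductive MoveB : Multiset ℕ → Multiset ℕ → Prop
  | one {G : Multiset ℕ} {p : ℕ} (hp : p ∈ G) (h1 : 1 ≤ p) : MoveB G (takeOne G p)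
  | all {G : Multiset ℕ} (hG : G ≠ 0) : MoveB G ((G.map (· - 1)).filter (· ≠ 0))

mutual
  /-- P-positions of Version B under normal play: every move leads to an N-position
  (in particular the empty position is a P-position).  Since every move strictly
  decreases the total number of tokens, this inductive definition agrees with the
  usual recursive definition of outcome classes. -/
  inductive PPosB : Multiset ℕ → Prop
    | mk : ∀ {G : Multiset ℕ}, (∀ H, MoveB G H → NPosB H) → PPosB G
  /-- N-positions of Version B under normal play: some move leads to a P-position. -/
  inductive NPosB : Multiset ℕ → Prop
    | mk : ∀ {G H : Multiset ℕ}, MoveB G H → PPosB H → NPosB G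
end

theorem mem_or_eq_of_mem_takeOne {G : Multiset ℕ} {p q : ℕ} (hq : q ∈ takeOne G p) :
    q ∈ G.erase p ∨ (p ≠ 1 ∧ q = p - 1) := by
  unfold takeOne at hq
  split_ifs at hq with h <;> simp_all

theorem sum_takeOne {G : Multiset ℕ} {p : ℕ} (hp : p ∈ G) (h1 : 1 ≤ p) :
    (takeOne G p).sum + 1 = G.sum := by
  have h := Multiset.sum_erase hp
  unfold takeOne
  split_ifs <;> simp <;> omega

theorem MoveB.zero_notMem {G H : Multiset ℕ} (hG : 0 ∉ G) (m : MoveB G H) : 0 ∉ H := by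
  cases m with
  | one hp h1 =>
    intro h0
    rcases mem_or_eq_of_mem_takeOne h0 with h | ⟨h, h'⟩
    · exact hG (Multiset.mem_of_mem_erase h)
    · omega
  | all => simp

theorem MoveB.sum_lt {G H : Multiset ℕ} (hG : 0 ∉ G) (m : MoveB G H) : H.sum < G.sum := by
  cases m with
  | one hp h1 => have := sum_takeOne hp h1; omega
  | all hne =>
    have hfilter : ((G.map (· - 1)).filter (· ≠ 0)).sum ≤ (G.map (· - 1)).sum := by
      obtain ⟨s, hs⟩ := Multiset.le_iff_exists_add.1 (Multiset.filter_le (· ≠ 0) (G.map (· - 1)))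
      conv_rhs => rw [hs, Multiset.sum_add]
      exact Nat.le_add_right _ _
    refine hfilter.trans_lt ?_
    have hlt : (G.map (· - 1)).sum < (G.map id).sum :=
      Multiset.sum_lt_sum_of_nonempty hne fun p hp => by
        have : p ≠ 0 := ne_of_mem_of_not_mem hp hG
        simp only [id]; omega
    simpa using hlt

/-- The reply to a move from an all-even position is to repeat that move. -/
theorem MoveB.exists_reply_even {G H : Multiset ℕ} (hG : 0 ∉ G) (h : ∀ p ∈ G, Even p)
    (m : MoveB G H) : ∃ K, MoveB H K ∧ ∀ p ∈ K, Even p := by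
  cases m with
  | @one p hp h1 =>
    obtain ⟨k, rfl⟩ := h p hp
    have hH : takeOne G (k + k) = G.erase (k + k) + {k + k - 1} := by
      rw [takeOne, if_neg (by omega)]
    have herase : (takeOne G (k + k)).erase (k + k - 1) = G.erase (k + k) := by
      rw [hH, Multiset.add_comm, Multiset.singleton_add, Multiset.erase_cons_head]
    refine ⟨_, .one (p := k + k - 1) (by simp [hH]) (by omega), fun q hq => ?_⟩
    rcases mem_or_eq_of_mem_takeOne hq with hq | ⟨_, rfl⟩
    · rw [herase] at hq
      exact h q (Multiset.mem_of_mem_erase hq)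
    · exact ⟨k - 1, by omega⟩
  | all hne =>
    refine ⟨_, .all ?_, fun q hq => ?_⟩
    · obtain ⟨p, hp⟩ := Multiset.exists_mem_of_ne_zero hne
      obtain ⟨k, rfl⟩ := h p hp
      have hk : k + k ≠ 0 := ne_of_mem_of_not_mem hp hG
      have hmem : k + k - 1 ∈ (G.map (· - 1)).filter (· ≠ 0) :=
        Multiset.mem_filter.2 ⟨Multiset.mem_map_of_mem _ hp, by omega⟩
      exact fun h0 => by simp [h0] at hmem
    · obtain ⟨r, hr, rfl⟩ := Multiset.mem_map.1 (Multiset.mem_filter.1 hq).1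
      obtain ⟨p, hp, rfl⟩ := Multiset.mem_map.1 (Multiset.mem_filter.1 hr).1
      obtain ⟨k, rfl⟩ := h p hp
      exact ⟨k - 1, by omega⟩

/-- In Version B, every position in which all pile sizes are even is a P-position. -/
theorem versionB_allEven_PPos (G : Multiset ℕ) (hG : 0 ∉ G)
    (h : ∀ p ∈ G, Even p) : PPosB G := by
  induction hn : G.sum using Nat.strong_induction_on generalizing G with
  | _ n ih =>
    refine .mk fun H m => ?_
    obtain ⟨K, m', hK⟩ := m.exists_reply_even hG h
    have hH := m.zero_notMem hG
    have hlt : K.sum < n := hn ▸ (m'.sum_lt hH).trans (m.sum_lt hG)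
    exact .mk m' (ih K.sum hlt K (m'.zero_notMem hH) hK rfl)
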